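/- arXiv:2406.13824 — 2 statements merged into one kernel-verified Lean document; each statement's English description precedes it below -/
import Mathlib

section
/- For two agents whose valuations are binary (v_{ij} ∈ {0,1} for all i ∈ [2] and j ∈ [m]), a symEF1 partition of the m items into two bundles always exists. -/
/-- Additive value of agent `i` for bundle `A`. -/
def bundleVal {n m : ℕ} (v : Fin n → Fin m → ℝ) (i : Fin n) (A : Finset (Fin m)) : ℝ :=
  ∑ j ∈ A, v i j

/-- Value of agent `i`'s favorite item in `A` (0 if `A` is empty). -/
def maxVal {n m : ℕ} (v : Fin n → Fin m → ℝ) (i : Fin n) (A : Finset (Fin m)) : ℝ :=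
  if h : A.Nonempty then A.sup' h (v i) else 0

/-- Value of agent `i`'s least-valued item in `A` (0 if `A` is empty). -/
def minVal {n m : ℕ} (v : Fin n → Fin m → ℝ) (i : Fin n) (A : Finset (Fin m)) : ℝ :=
  if h : A.Nonempty then A.inf' h (v i) else 0

/-- `(A 1, …, A n)` is a partition of the items: every item is in exactly one bundle. -/
def IsPartition {n m : ℕ} (A : Fin n → Finset (Fin m)) : Prop :=
  ∀ j : Fin m, ∃! k : Fin n, j ∈ A k

/-- Symmetrically envy free up to one good. -/
def SymEF1 {n m : ℕ} (v : Fin n → Fin m → ℝ) (A : Fin n → Finset (Fin m)) : Prop :=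
  ∀ i k l : Fin n, bundleVal v i (A k) ≥ bundleVal v i (A l) - maxVal v i (A l)

/-- Symmetrically envy free up to any good. -/
def SymEFX {n m : ℕ} (v : Fin n → Fin m → ℝ) (A : Fin n → Finset (Fin m)) : Prop :=
  ∀ i k l : Fin n, bundleVal v i (A k) ≥ bundleVal v i (A l) - minVal v i (A l)

/-- `σ` is a ranking for agent `i`: `σ` lists the items from most to least favorite. -/
def IsRanking {n m : ℕ} (v : Fin n → Fin m → ℝ) (i : Fin n) (σ : Equiv.Perm (Fin m)) : Prop :=
  ∀ (j : ℕ) (h : j + 1 < m), v i (σ ⟨j + 1, h⟩) ≤ v i (σ ⟨j, Nat.lt_of_succ_lt h⟩)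

/-- The `t`-th indexed `n`-tuple (0-indexed `t`) for the ranking `σ`:
    the items ranked in positions `n*t, …, n*t + n - 1` (0-indexed, positions `< m`). -/
def nTuple {m : ℕ} (n : ℕ) (σ : Equiv.Perm (Fin m)) (t : ℕ) : Finset (Fin m) :=
  (Finset.univ.filter (fun p : Fin m => p.val / n = t)).image σ

/-- The `l`-th bundle (0-indexed `l`) of the round-robin allocation of the agent whose
    ranking is `σ`: the items ranked in positions congruent to `l` modulo `n`. -/
def rrBundle {m : ℕ} (n : ℕ) (σ : Equiv.Perm (Fin m)) (l : ℕ) : Finset (Fin m) :=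
  (Finset.univ.filter (fun p : Fin m => p.val % n = l)).image σ

/-- The partition `A` separates the indexed `n`-tuples induced by the ranking `σ`:
    no two distinct items of a common `n`-tuple lie in the same bundle. -/
def Separates {n m : ℕ} (σ : Equiv.Perm (Fin m)) (A : Fin n → Finset (Fin m)) : Prop :=
  ∀ (t : ℕ), ∀ j1 ∈ nTuple n σ t, ∀ j2 ∈ nTuple n σ t, j1 ≠ j2 →
    ∀ k : Fin n, j1 ∈ A k → j2 ∉ A k

/-- The item graph: vertices are the items, with an edge between two distinct items
    whenever they belong to a common indexed `n`-tuple of some agent. -/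
def itemGraph {m : ℕ} (n : ℕ) (σ : Fin n → Equiv.Perm (Fin m)) : SimpleGraph (Fin m) :=
  SimpleGraph.fromRel (fun j1 j2 => ∃ (i : Fin n) (t : ℕ),
    j1 ∈ nTuple n (σ i) t ∧ j2 ∈ nTuple n (σ i) t)

open Finset

/-- With binary valuations, the value of a bundle counts its items of value one. -/
lemma bundleVal_eq_card {n m : ℕ} {v : Fin n → Fin m → ℝ} (hv : ∀ i j, v i j = 0 ∨ v i j = 1)
    (i : Fin n) (A : Finset (Fin m)) : bundleVal v i A = #(A.filter (v i · = 1)) := by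
  rw [bundleVal, card_filter, Nat.cast_sum]
  refine sum_congr rfl fun j _ => ?_
  rcases hv i j with h | h <;> simp [h]

lemma le_maxVal {n m : ℕ} (v : Fin n → Fin m → ℝ) (i : Fin n) {A : Finset (Fin m)} {j : Fin m}
    (hj : j ∈ A) : v i j ≤ maxVal v i A := by
  rw [maxVal, dif_pos ⟨j, hj⟩]
  exact le_sup' (v i) hj

lemma maxVal_nonneg {n m : ℕ} {v : Fin n → Fin m → ℝ} (hv : ∀ i j, 0 ≤ v i j) (i : Fin n)
    (A : Finset (Fin m)) : 0 ≤ maxVal v i A := by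
  rcases A.eq_empty_or_nonempty with rfl | ⟨j, hj⟩
  · simp [maxVal]
  · exact (hv i j).trans (le_maxVal v i hj)

/-- With binary valuations, it suffices for symEF1 that every agent's numbers of valued items in
any two bundles differ by at most one. -/
lemma symEF1_of_card_le {n m : ℕ} {v : Fin n → Fin m → ℝ} (hv : ∀ i j, v i j = 0 ∨ v i j = 1)
    {A : Fin n → Finset (Fin m)}
    (hA : ∀ i k l, #((A l).filter (v i · = 1)) ≤ #((A k).filter (v i · = 1)) + 1) :
    SymEF1 v A := by
  intro i k l
  rw [bundleVal_eq_card hv, bundleVal_eq_card hv]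
  rcases ((A l).filter (v i · = 1)).eq_empty_or_nonempty with h | ⟨j, hj⟩
  · have hmax : 0 ≤ maxVal v i (A l) :=
      maxVal_nonneg (fun i j => by rcases hv i j with h | h <;> simp [h]) i _
    have hcard : (0 : ℝ) ≤ #((A k).filter (v i · = 1)) := Nat.cast_nonneg _
    rw [h, card_empty, Nat.cast_zero]
    linarith
  · obtain ⟨hjA, hj⟩ := mem_filter.1 hj
    have hmax := le_maxVal v i hjA
    have hcard : (#((A l).filter (v i · = 1)) : ℝ) ≤ #((A k).filter (v i · = 1)) + 1 :=
      mod_cast hA i k l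
    linarith

lemma isPartition_compl {m : ℕ} (B : Finset (Fin m)) : IsPartition ![B, Bᶜ] := by
  intro j
  by_cases hj : j ∈ B
  · exact ⟨0, by simpa using hj, fun k hk => by fin_cases k <;> simp_all⟩
  · exact ⟨1, by simpa using hj, fun k hk => by fin_cases k <;> simp_all⟩

/-- for two agents with binary valuations, a symEF1 partition always exists. -/
theorem statement2 {m : ℕ} (v : Fin 2 → Fin m → ℝ)
    (hv : ∀ i j, v i j = 0 ∨ v i j = 1) :
    ∃ A : Fin 2 → Finset (Fin m), IsPartition A ∧ SymEF1 v A := by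
  let P : Fin 2 → Finset (Fin m) := fun i => univ.filter (v i · = 1)
  obtain ⟨T, hTP, hT⟩ := exists_subset_card_eq (s := P 0 ∩ P 1) (n := #(P 0 ∩ P 1) / 2) (by omega)
  obtain ⟨U, hUP, hU⟩ :=
    exists_subset_card_eq (s := P 0 \ P 1) (n := (#(P 0 \ P 1) + 1) / 2) (by omega)
  obtain ⟨W, hWP, hW⟩ :=
    exists_subset_card_eq (s := P 1 \ P 0) (n := (#(P 1 \ P 0) + 1) / 2) (by omega)
  have card_zero := card_sdiff_add_card_inter (P 0) (P 1)
  have card_one := card_sdiff_add_card_inter (P 1) (P 0)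
  rw [inter_comm (P 1)] at card_one
  have first_zero : #((T ∪ U ∪ W).filter (v 0 · = 1)) = #T + #U := by
    rw [← card_union_of_disjoint]
    · congr 1
      ext j
      have h₁ := @hTP j
      have h₂ := @hUP j
      have h₃ := @hWP j
      simp only [P, mem_inter, mem_sdiff, mem_filter, mem_univ, true_and, mem_union] at *
      tauto
    · refine disjoint_left.2 fun j hj hj' => ?_
      exact (mem_sdiff.1 (hUP hj')).2 (mem_inter.1 (hTP hj)).2
  have first_one : #((T ∪ U ∪ W).filter (v 1 · = 1)) = #T + #W := by
    rw [← card_union_of_disjoint]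
    · congr 1
      ext j
      have h₁ := @hTP j
      have h₂ := @hUP j
      have h₃ := @hWP j
      simp only [P, mem_inter, mem_sdiff, mem_filter, mem_univ, true_and, mem_union] at *
      tauto
    · refine disjoint_left.2 fun j hj hj' => ?_
      exact (mem_sdiff.1 (hWP hj')).2 (mem_inter.1 (hTP hj)).1
  have total (i : Fin 2) : #((T ∪ U ∪ W).filter (v i · = 1)) +
      #((T ∪ U ∪ W)ᶜ.filter (v i · = 1)) = #(P i) := by
    rw [← card_union_of_disjoint (disjoint_filter_filter disjoint_compl_right), ← filter_union,
      union_compl]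
  have total_zero := total 0
  have total_one := total 1
  refine ⟨![T ∪ U ∪ W, (T ∪ U ∪ W)ᶜ], isPartition_compl _, symEF1_of_card_le hv ?_⟩
  intro i k l
  fin_cases i <;> fin_cases k <;> fin_cases l <;>
    simp only [Fin.zero_eta, Fin.mk_one, Matrix.cons_val_zero, Matrix.cons_val_one] <;> omega
end

section
/- Let n = 2 and let m be even. Fix a ranking σ_i for each of the two agents and form the family 𝒯 of indexed 2-tuples T_i^t = {σ_i(2t−1), σ_i(2t)} for t ∈ [m/2] and i ∈ [2]. Then the item graph G(𝒯) contains no odd cycle; equivalently, G(𝒯) is bipartite and admits a proper 2-coloring. -/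
/-- If two involutions have no fixed points, then no reflection of the dihedral group they
generate has a fixed point. -/
theorem Equiv.Perm.not_sameCycle_mul_apply_of_involutive {α : Type*} {f g : Equiv.Perm α}
    (hf : Function.Involutive f) (hg : Function.Involutive g)
    (hf' : ∀ x, f x ≠ x) (hg' : ∀ x, g x ≠ x) (x : α) :
    ¬ (g * f).SameCycle x (f x) := by
  have hff : f⁻¹ = f := by
    ext y
    rw [Equiv.Perm.inv_eq_iff_eq, hf y]
  have hgg : g⁻¹ = g := by
    ext y
    rw [Equiv.Perm.inv_eq_iff_eq, hg y]
  have hconj : ∀ j : ℤ, f * (g * f) ^ j = (g * f) ^ (-j) * f := by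
    intro j
    have h1 : f * (g * f) * f⁻¹ = (g * f)⁻¹ := by
      rw [mul_inv_rev, hgg, ← mul_assoc, mul_inv_cancel_right, hff]
    have h2 := conj_zpow (a := f) (b := g * f) (i := j)
    rw [h1, inv_zpow', eq_comm, mul_inv_eq_iff_eq_mul] at h2
    exact h2
  have hswap : ∀ j : ℤ, f (((g * f) ^ j) x) = ((g * f) ^ (-j)) (f x) := fun j => by
    simpa using congrArg (fun p : Equiv.Perm α => p x) (hconj j)
  rintro ⟨k, hk⟩
  obtain ⟨j, rfl⟩ | ⟨j, rfl⟩ := k.even_or_odd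
  · apply hf' (((g * f) ^ j) x)
    rw [hswap, ← hk, ← Equiv.Perm.mul_apply, ← zpow_add]
    simp
  · apply hg' (f (((g * f) ^ j) x))
    have h3 : ((g * f) ^ (-j)) (f x) = (g * f) (((g * f) ^ j) x) := by
      rw [← hk, ← Equiv.Perm.mul_apply, ← zpow_add, ← Equiv.Perm.mul_apply, ← zpow_one_add]
      congr 2
      ring
    rw [← Equiv.Perm.mul_apply, ← h3, hswap]

/-- Two fixed-point-free involutions admit a common 2-coloring that both of them flip. -/
theorem Equiv.Perm.exists_bool_coloring_of_involutive {α : Type*} [LinearOrder α]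
    {f g : Equiv.Perm α} (hf : Function.Involutive f) (hg : Function.Involutive g)
    (hf' : ∀ x, f x ≠ x) (hg' : ∀ x, g x ≠ x) :
    ∃ c : α → Bool, ∀ x, c (f x) ≠ c x ∧ c (g x) ≠ c x := by
  let S := Equiv.Perm.SameCycle.setoid (g * f)
  let r : α → α := fun x => (Quotient.mk S x).out
  have hr : ∀ x y, r x = r y ↔ (g * f).SameCycle x y := fun x y =>
    Quotient.out_inj.trans Quotient.eq
  have hgf : ∀ x, r (g x) = r (f x) := fun x =>
    ((hr _ _).2 ⟨1, by simp [hf x]⟩).symm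
  have hfg : ∀ x, r (f (g x)) = r x := fun x => by
    rw [← hgf, hg x]
  have hne : ∀ x, r x ≠ r (f x) := fun x h =>
    Equiv.Perm.not_sameCycle_mul_apply_of_involutive hf hg hf' hg' x ((hr _ _).1 h)
  have hflip : ∀ x, decide (r (f x) < r x) ≠ decide (r x < r (f x)) := by
    intro x
    rcases lt_or_gt_of_ne (hne x) with h | h <;> simp [h, h.le]
  refine ⟨fun x => decide (r x < r (f x)), fun x => ⟨?_, ?_⟩⟩
  · simpa only [hf x] using hflip x
  · simpa only [hgf, hfg] using hflip x

/-- The involution of `Fin m`, `m` even, exchanging the positions `2 * t` and `2 * t + 1`. -/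
theorem Fin.exists_involutive_div_two {m : ℕ} (hm : Even m) :
    ∃ s : Equiv.Perm (Fin m), Function.Involutive s ∧ (∀ p, s p ≠ p) ∧
      ∀ p q : Fin m, p ≠ q → p.val / 2 = q.val / 2 → s p = q := by
  obtain ⟨k, rfl⟩ := hm
  let s : Fin (k + k) → Fin (k + k) := fun p =>
    ⟨if p.val % 2 = 0 then p.val + 1 else p.val - 1, by split_ifs <;> omega⟩
  have hs : Function.Involutive s := by
    intro p
    ext
    simp only [s]
    split_ifs <;> omega
  refine ⟨hs.toPerm, hs, fun p h => ?_, fun p q hpq h => ?_⟩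
  · have := congrArg Fin.val h
    simp only [Function.Involutive.coe_toPerm, s] at this
    split_ifs at this <;> omega
  · ext
    have : p.val ≠ q.val := fun h => hpq (Fin.ext h)
    simp only [Function.Involutive.coe_toPerm, s]
    split_ifs <;> omega

theorem mem_nTuple_iff {m n : ℕ} {σ : Equiv.Perm (Fin m)} {t : ℕ} {j : Fin m} :
    j ∈ nTuple n σ t ↔ (σ.symm j).val / n = t := by
  simp only [nTuple, Finset.mem_image, Finset.mem_filter, Finset.mem_univ, true_and]
  constructor
  · rintro ⟨p, hp, rfl⟩
    simpa using hp
  · exact fun h => ⟨_, h, by simp⟩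

/-- For `m` even, some fixed-point-free involution exchanges the two items of every indexed
2-tuple. -/
theorem exists_involutive_of_nTuple {m : ℕ} (hm : Even m) (σ : Equiv.Perm (Fin m)) :
    ∃ f : Equiv.Perm (Fin m), Function.Involutive f ∧ (∀ j, f j ≠ j) ∧
      ∀ t, ∀ j₁ ∈ nTuple 2 σ t, ∀ j₂ ∈ nTuple 2 σ t, j₁ ≠ j₂ → f j₁ = j₂ := by
  obtain ⟨s, hs, hs', hpair⟩ := Fin.exists_involutive_div_two hm
  refine ⟨σ.symm.trans (s.trans σ), fun j => ?_, fun j h => ?_, fun t j₁ h₁ j₂ h₂ hne => ?_⟩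
  · simp [hs _]
  · apply hs' (σ.symm j)
    rw [Equiv.eq_symm_apply]
    exact h
  · have := hpair (σ.symm j₁) (σ.symm j₂) (σ.symm.injective.ne hne)
      ((mem_nTuple_iff.1 h₁).trans (mem_nTuple_iff.1 h₂).symm)
    simp [this]

theorem exists_bool_coloring_itemGraph {m : ℕ} (hm : Even m)
    (σ : Fin 2 → Equiv.Perm (Fin m)) : Nonempty ((itemGraph 2 σ).Coloring Bool) := by
  obtain ⟨f, hf, hf', hfσ⟩ := exists_involutive_of_nTuple hm (σ 0)
  obtain ⟨g, hg, hg', hgσ⟩ := exists_involutive_of_nTuple hm (σ 1)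
  obtain ⟨c, hc⟩ := Equiv.Perm.exists_bool_coloring_of_involutive hf hg hf' hg'
  have key : ∀ j₁ j₂ : Fin m, j₁ ≠ j₂ → ∀ (i : Fin 2) (t : ℕ),
      j₁ ∈ nTuple 2 (σ i) t → j₂ ∈ nTuple 2 (σ i) t → c j₁ ≠ c j₂ := by
    intro j₁ j₂ hne i t h₁ h₂
    fin_cases i
    · rw [← hfσ t j₁ h₁ j₂ h₂ hne]
      exact (hc j₁).1.symm
    · rw [← hgσ t j₁ h₁ j₂ h₂ hne]
      exact (hc j₁).2.symm
  refine ⟨SimpleGraph.Coloring.mk c fun {j₁ j₂} hadj => ?_⟩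
  rw [itemGraph, SimpleGraph.fromRel_adj] at hadj
  obtain ⟨hne, ⟨i, t, h₁, h₂⟩ | ⟨i, t, h₂, h₁⟩⟩ := hadj
  all_goals exact key j₁ j₂ hne i t h₁ h₂

/-- for two agents and an even number of items, the item graph contains no
odd cycle; equivalently, it is bipartite, i.e., admits a proper 2-coloring. -/
theorem statement9 {m : ℕ} (hm : Even m) (v : Fin 2 → Fin m → ℝ)
    (hv : ∀ i j, 0 ≤ v i j ∧ v i j ≤ 1)
    (σ : Fin 2 → Equiv.Perm (Fin m)) (hσ : ∀ i, IsRanking v i (σ i)) :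
    (∀ (u : Fin m) (w : (itemGraph 2 σ).Walk u u), w.IsCycle → Even w.length) ∧
    (itemGraph 2 σ).Colorable 2 := by
  obtain ⟨c⟩ := exists_bool_coloring_itemGraph hm σ
  exact ⟨fun u w _ => (c.even_length_iff_congr w).2 Iff.rfl, c.colorable⟩
end
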